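/- Let s and t be natural numbers such that n := s + t is odd and n(n−1)/2 + t is odd (equivalently, the pseudoscalar of G(s,t) squares to −1). Then G(s, t) is isomorphic as an ℝ-algebra to G⁺(s, t) ⊗[ℝ] ℂ, and also isomorphic as an ℝ-algebra to the complex Clifford algebra Gℂ(s + t − 1). -/

import Mathlib

open scoped TensorProduct

/-- The quadratic form of signature `(s, t)` on `ℝ^(s+t)`:
`Q x = Σ_{i < s} x i ^ 2 - Σ_{s ≤ i < s+t} x i ^ 2`. -/
noncomputable def Qst (s t : ℕ) : QuadraticForm ℝ (Fin (s + t) → ℝ) :=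
  QuadraticMap.weightedSumSquares ℝ
    (fun i : Fin (s + t) => if (i : ℕ) < s then (1 : ℝ) else -1)

/-- The standard nondegenerate quadratic form `z ↦ Σ_{i < n} z i ^ 2` on `ℂⁿ`. -/
noncomputable def QC (n : ℕ) : QuadraticForm ℂ (Fin n → ℂ) :=
  QuadraticMap.weightedSumSquares ℂ (fun _ : Fin n => (1 : ℂ))

open CliffordAlgebra QuadraticMap

section Complexification

variable {M : Type*} [AddCommGroup M] [Module ℝ M] {Q : QuadraticForm ℝ M}

/-- The multiplication map `a ⊗ z ↦ a * (re z + im z • ω)` for a central square root `ω` of `-1`. -/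
noncomputable def evenTensorComplexHom (ω : CliffordAlgebra Q) (hω : ω * ω = -1)
    (hcomm : ∀ a, Commute a ω) : even Q ⊗[ℝ] ℂ →ₐ[ℝ] CliffordAlgebra Q :=
  Algebra.TensorProduct.lift (even Q).val (Complex.liftAux ω hω) fun a z => by
    rw [Complex.liftAux_apply]
    exact (Algebra.commute_algebraMap_right z.re (a : CliffordAlgebra Q)).add_right
      ((hcomm a).smul_right _)

lemma exists_eq_tmul_one_add_tmul_I {A : Type*} [Ring A] [Algebra ℝ A] (x : A ⊗[ℝ] ℂ) :
    ∃ a b : A, x = a ⊗ₜ 1 + b ⊗ₜ Complex.I := by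
  induction x with
  | zero => exact ⟨0, 0, by simp⟩
  | tmul a z =>
    refine ⟨z.re • a, z.im • a, ?_⟩
    rw [TensorProduct.smul_tmul, TensorProduct.smul_tmul, ← TensorProduct.tmul_add]
    congr 1
    simp
  | add x y hx hy =>
    obtain ⟨a, b, rfl⟩ := hx
    obtain ⟨c, d, rfl⟩ := hy
    exact ⟨a + c, b + d, by simp only [TensorProduct.add_tmul]; abel⟩

theorem evenTensorComplexHom_bijective (ω : CliffordAlgebra Q) (hω : ω * ω = -1)
    (hcomm : ∀ a, Commute a ω) (hodd : ω ∈ evenOdd Q 1) :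
    Function.Bijective (evenTensorComplexHom ω hω hcomm) := by
  have happ (a b : even Q) : evenTensorComplexHom ω hω hcomm (a ⊗ₜ 1 + b ⊗ₜ Complex.I)
      = a + b * ω := by
    simp [evenTensorComplexHom, Complex.liftAux_apply]
  constructor
  · rw [injective_iff_map_eq_zero]
    intro x hx
    obtain ⟨a, b, rfl⟩ := exists_eq_tmul_one_add_tmul_I x
    rw [happ] at hx
    have hbω : (b : CliffordAlgebra Q) * ω ∈ evenOdd Q 1 := by
      simpa using evenOdd_mul_le Q 0 1 (Submodule.mul_mem_mul b.2 hodd)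
    have ha : (a : CliffordAlgebra Q) = 0 :=
      Submodule.disjoint_def.1 (evenOdd_isCompl (Q := Q)).disjoint _ a.2
        (by rw [eq_neg_of_add_eq_zero_left hx]; exact neg_mem hbω)
    have hb : (b : CliffordAlgebra Q) = 0 := by
      rw [ha, zero_add] at hx
      simpa [mul_assoc, hω] using congrArg (· * ω) hx
    rw [ZeroMemClass.coe_eq_zero.1 ha, ZeroMemClass.coe_eq_zero.1 hb]
    simp
  · intro x
    obtain ⟨y, hy, z, hz, rfl⟩ := Submodule.mem_sup.1
      ((evenOdd_isCompl (Q := Q)).sup_eq_top ▸ Submodule.mem_top (x := x))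
    have hzω : -(z * ω) ∈ even Q := by
      refine neg_mem ?_
      have := evenOdd_mul_le Q 1 1 (Submodule.mul_mem_mul hz hodd)
      rwa [show (1 + 1 : ZMod 2) = 0 from rfl] at this
    refine ⟨(⟨y, hy⟩ : even Q) ⊗ₜ 1 + (⟨_, hzω⟩ : even Q) ⊗ₜ Complex.I, ?_⟩
    rw [happ]
    simp [mul_assoc, hω]

end Complexification

section AnticommutingProducts

variable {A : Type*} [Ring A] {e : ℕ → A}

lemma mul_prod_range_of_anticomm (he : ∀ i j, i ≠ j → e i * e j = -(e j * e i)) (j k : ℕ) :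
    e j * ((List.range k).map e).prod =
      (-1) ^ (k + if j < k then 1 else 0) * (((List.range k).map e).prod * e j) := by
  induction k with
  | zero => simp
  | succ k ih =>
    rw [List.range_succ, List.map_append, List.prod_append, ← mul_assoc, ih]
    simp only [List.map_singleton, List.prod_singleton]
    rcases lt_trichotomy j k with h | rfl | h
    · simp [h, Nat.lt_succ_of_lt h, mul_assoc, he j k h.ne, pow_succ]
    · simp [mul_assoc, pow_succ]
    · have h₁ : ¬ j < k := by omega
      have h₂ : ¬ j < k + 1 := by omega
      simp [h₁, h₂, mul_assoc, he j k h.ne', pow_succ]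

lemma prod_range_mul_self_of_anticomm (he : ∀ i j, i ≠ j → e i * e j = -(e j * e i))
    {s t : ℕ} (hpos : ∀ i < s, e i * e i = 1)
    (hneg : ∀ i, s ≤ i → i < s + t → e i * e i = -1) (k : ℕ) (hk : k ≤ s + t) :
    ((List.range k).map e).prod * ((List.range k).map e).prod =
      (-1) ^ (k * (k - 1) / 2 + (k - s)) := by
  induction k with
  | zero => simp
  | succ k ih =>
    have hsq : e k * e k = (-1) ^ (if k < s then 0 else 1) := by
      split_ifs with h
      · simpa using hpos k h
      · simpa using hneg k (by omega) (by omega)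
    have hexp : (k + 1) * (k + 1 - 1) / 2 + (k + 1 - s) =
        k + (k * (k - 1) / 2 + (k - s)) + (if k < s then 0 else 1) := by
      rw [← Nat.choose_two_right, ← Nat.choose_two_right, Nat.choose_succ_succ' k 1,
        Nat.choose_one_right, one_add_one_eq_two]
      split_ifs <;> omega
    rw [List.range_succ, List.map_append, List.prod_append]
    simp only [List.map_singleton, List.prod_singleton]
    set P := ((List.range k).map e).prod
    have hswap : e k * P = (-1) ^ k * (P * e k) := by
      simpa using mul_prod_range_of_anticomm he k k
    calc P * e k * (P * e k) = P * (e k * P) * e k := by simp only [mul_assoc]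
      _ = (-1) ^ k * (P * P * (e k * e k)) := by
        rw [hswap, ← mul_assoc P, ((Commute.neg_one_right P).pow_right k).eq]
        simp only [mul_assoc]
      _ = _ := by
        rw [ih (by omega), hsq, hexp, pow_add (-1 : A) (k + _), pow_add (-1 : A) k, mul_assoc]

end AnticommutingProducts

section Pseudoscalar

variable (s t : ℕ)

/-- The `i`-th standard generator of `G(s,t)`, which is zero for `s + t ≤ i`. -/
noncomputable def stdGen (i : ℕ) : CliffordAlgebra (Qst s t) :=
  ι (Qst s t) fun j => if (j : ℕ) = i then 1 else 0

lemma stdGen_anticomm (i j : ℕ) (hij : i ≠ j) :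
    stdGen s t i * stdGen s t j = -(stdGen s t j * stdGen s t i) := by
  refine ι_mul_ι_comm_of_isOrtho ?_
  rw [isOrtho_def]
  simp only [Qst, weightedSumSquares_apply, ← Finset.sum_add_distrib]
  refine Finset.sum_congr rfl fun k _ => ?_
  by_cases h₁ : (k : ℕ) = i <;> by_cases h₂ : (k : ℕ) = j
  · omega
  all_goals simp [h₁, h₂, hij, hij.symm]

lemma stdGen_mul_self {i : ℕ} (hi : i < s + t) :
    stdGen s t i * stdGen s t i = if i < s then 1 else -1 := by
  rw [stdGen, ι_sq_scalar, Qst, weightedSumSquares_apply,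
    Finset.sum_eq_single (⟨i, hi⟩ : Fin (s + t))]
  · split_ifs <;> simp_all
  · intro j _ hj
    have : (j : ℕ) ≠ i := fun h => hj (Fin.ext h)
    simp [this]
  · simp

lemma ι_eq_sum_stdGen (v : Fin (s + t) → ℝ) :
    ι (Qst s t) v = ∑ i : Fin (s + t), v i • stdGen s t i := by
  simp only [stdGen, ← map_smul, ← map_sum]
  congr 1
  ext j
  simp [Fin.val_inj]

/-- The pseudoscalar of `G(s,t)`. -/
noncomputable def pseudoscalar : CliffordAlgebra (Qst s t) :=
  ((List.range (s + t)).map (stdGen s t)).prod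

variable {s t}

lemma pseudoscalar_mul_self (hI : Odd ((s + t) * (s + t - 1) / 2 + t)) :
    pseudoscalar s t * pseudoscalar s t = -1 := by
  rw [pseudoscalar, prod_range_mul_self_of_anticomm (stdGen_anticomm s t) (s := s) (t := t)
    (fun i hi => by rw [stdGen_mul_self s t (by omega), if_pos hi])
    (fun i hi hi' => by rw [stdGen_mul_self s t hi', if_neg (by omega)]) _ le_rfl,
    Nat.add_sub_cancel_left, hI.neg_one_pow]

lemma pseudoscalar_commute (hodd : Odd (s + t)) (a : CliffordAlgebra (Qst s t)) :
    Commute a (pseudoscalar s t) := by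
  induction a using CliffordAlgebra.induction with
  | algebraMap r => exact Algebra.commutes r _
  | ι v =>
    rw [ι_eq_sum_stdGen]
    refine Commute.sum_left _ _ _ fun i _ => Commute.smul_left ?_ _
    have := mul_prod_range_of_anticomm (stdGen_anticomm s t) i (s + t)
    rwa [if_pos i.2, hodd.add_one.neg_one_pow, one_mul] at this
  | mul a b ha hb => exact ha.mul_left hb
  | add a b ha hb => exact ha.add_left hb

lemma pseudoscalar_mem_evenOdd_one (hodd : Odd (s + t)) :
    pseudoscalar s t ∈ evenOdd (Qst s t) 1 := by
  have h := SetLike.list_prod_map_mem_graded (A := evenOdd (Qst s t)) (List.range (s + t))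
    (fun _ => (1 : ZMod 2)) (stdGen s t) fun i _ => ι_mem_evenOdd_one _ _
  have hsum : ((List.range (s + t)).map fun _ => (1 : ZMod 2)).sum = 1 := by
    rw [List.map_const', List.sum_replicate, List.length_range, nsmul_one]
    exact (ZMod.natCast_eq_one_iff_odd).2 hodd
  rwa [hsum] at h

end Pseudoscalar

section EvenSubalgebra

/-- Over `ℂ`, a diagonal real quadratic form with nonzero weights becomes a sum of squares. -/
theorem nonempty_isometryEquiv_baseChange_QC {m : ℕ} {w : Fin m → ℝ} (hw : ∀ i, w i ≠ 0) :
    Nonempty ((QuadraticForm.baseChange ℂ (weightedSumSquares ℝ w)).IsometryEquiv (QC m)) := by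
  choose c hc using fun i => IsAlgClosed.exists_eq_mul_self (w i : ℂ)
  have hc₀ (i) : c i ≠ 0 := by
    rintro h
    apply hw i
    simpa [h] using hc i
  let f : ℂ ⊗[ℝ] (Fin m → ℝ) ≃ₗ[ℂ] (Fin m → ℂ) :=
    TensorProduct.piScalarRight ℝ ℂ ℂ (Fin m) ≪≫ₗ
      LinearEquiv.piCongrRight fun i => LinearEquiv.smulOfNeZero ℂ ℂ (c i) (hc₀ i)
  have key : (QC m).comp f.toLinearMap = QuadraticForm.baseChange ℂ (weightedSumSquares ℝ w) := by
    refine baseChange_ext fun v => ?_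
    rw [QuadraticForm.baseChange_tmul]
    simp only [QC, comp_apply, weightedSumSquares_apply, f]
    simp
    refine Finset.sum_congr rfl fun i _ => ?_
    rw [hc]
    ring
  exact ⟨⟨f, fun v => congrArg (fun q => q v) key⟩⟩

theorem nonempty_complexification_equiv_QC {m : ℕ} {w : Fin m → ℝ} (hw : ∀ i, w i ≠ 0) :
    Nonempty (CliffordAlgebra (weightedSumSquares ℝ w) ⊗[ℝ] ℂ ≃ₐ[ℝ] CliffordAlgebra (QC m)) := by
  obtain ⟨f⟩ := nonempty_isometryEquiv_baseChange_QC hw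
  exact ⟨(Algebra.TensorProduct.comm ℝ _ ℂ).trans
    (((equivBaseChange ℂ _).symm.trans (equivOfIsometry f)).restrictScalars ℝ)⟩

/-- Splitting off a negative first coordinate of a diagonal form. -/
noncomputable def isometryEquivConsNegOne {m : ℕ} (w : Fin (m + 1) → ℝ) (h₀ : w 0 = -1) :
    (EquivEven.Q' (weightedSumSquares ℝ fun i : Fin m => w i.succ)).IsometryEquiv
      (weightedSumSquares ℝ w) where
  toLinearEquiv := LinearEquiv.prodComm ℝ _ _ ≪≫ₗ Fin.consLinearEquiv ℝ fun _ => ℝ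
  map_app' v := by
    simp [weightedSumSquares_apply, Fin.sum_univ_succ, h₀, Fin.consLinearEquiv]
    ring

section Isometry

variable {R M N : Type*} [CommRing R] [AddCommGroup M] [Module R M] [AddCommGroup N] [Module R N]
  {Q₁ : QuadraticForm R M} {Q₂ : QuadraticForm R N}

/-- The homomorphism between even subalgebras induced by an isometry. -/
noncomputable def evenMap (f : Q₁ →qᵢ Q₂) : even Q₁ →ₐ[R] even Q₂ :=
  even.lift Q₁
    { bilin := (even.ι Q₂).bilin.compl₁₂ f.toLinearMap f.toLinearMap
      contract := fun m => by
        simpa using (even.ι Q₂).contract (f m)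
      contract_mid := fun m₁ m₂ m₃ => by
        simpa using (even.ι Q₂).contract_mid (f m₁) (f m₂) (f m₃) }

@[simp]
lemma evenMap_ι (f : Q₁ →qᵢ Q₂) (m₁ m₂ : M) :
    evenMap f ((even.ι Q₁).bilin m₁ m₂) = (even.ι Q₂).bilin (f m₁) (f m₂) :=
  even.lift_ι Q₁ _ m₁ m₂

/-- An isometric equivalence induces an isomorphism of even subalgebras. -/
noncomputable def evenEquivOfIsometry (f : Q₁.IsometryEquiv Q₂) : even Q₁ ≃ₐ[R] even Q₂ :=
  AlgEquiv.ofAlgHom (evenMap f.toIsometry) (evenMap f.symm.toIsometry)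
    (by ext m₁ m₂ : 4; simp) (by ext m₁ m₂ : 4; simp)

end Isometry

theorem nonempty_even_complexification_equiv_QC {m : ℕ} {w : Fin (m + 1) → ℝ}
    (hw : ∀ i, w i ≠ 0) (h₀ : w 0 = -1) :
    Nonempty (even (weightedSumSquares ℝ w) ⊗[ℝ] ℂ ≃ₐ[ℝ] CliffordAlgebra (QC m)) := by
  obtain ⟨g⟩ := nonempty_complexification_equiv_QC fun i : Fin m => hw i.succ
  exact ⟨(Algebra.TensorProduct.congr ((evenEquivOfIsometry (isometryEquivConsNegOne w h₀)).symm.trans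
    (equivEven _).symm) AlgEquiv.refl).trans g⟩

theorem nonempty_even_complexification_equiv_QC_pred {n : ℕ} (hn : n ≠ 0) {w : Fin n → ℝ}
    (hw : ∀ i, w i = 1 ∨ w i = -1) :
    Nonempty (even (weightedSumSquares ℝ w) ⊗[ℝ] ℂ ≃ₐ[ℝ] CliffordAlgebra (QC (n - 1))) := by
  obtain ⟨m, rfl⟩ := Nat.exists_eq_succ_of_ne_zero hn
  have hw₀ (i) : w i ≠ 0 := by rcases hw i with h | h <;> simp [h]
  rcases hw 0 with h | h
  · have hneg : -weightedSumSquares ℝ w = weightedSumSquares ℝ (-w) := by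
      ext v
      simp [weightedSumSquares_apply]
    obtain ⟨g⟩ := nonempty_even_complexification_equiv_QC (w := -w) (by simpa using hw₀)
      (by simp [h])
    rw [← hneg] at g
    exact ⟨(Algebra.TensorProduct.congr (evenEquivEvenNeg _) AlgEquiv.refl).trans g⟩
  · exact nonempty_even_complexification_equiv_QC hw₀ h

end EvenSubalgebra

/-- **Real Clifford algebras of odd dimension with `I² = -1` as complexifications:**
if `n := s + t` is odd and `n(n-1)/2 + t` is odd (so the pseudoscalar squares to `-1`),
then `G(s,t) ≅ G⁺(s,t) ⊗[ℝ] ℂ ≅ Gℂ(s+t-1)` as ℝ-algebras. -/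
theorem odd_clifford_complexification (s t : ℕ)
    (hodd : Odd (s + t)) (hI : Odd ((s + t) * (s + t - 1) / 2 + t)) :
    Nonempty (CliffordAlgebra (Qst s t) ≃ₐ[ℝ]
      ((CliffordAlgebra.even (Qst s t)) ⊗[ℝ] ℂ)) ∧
    Nonempty (CliffordAlgebra (Qst s t) ≃ₐ[ℝ] CliffordAlgebra (QC (s + t - 1))) := by
  let f := AlgEquiv.ofBijective _ <| evenTensorComplexHom_bijective (pseudoscalar s t)
    (pseudoscalar_mul_self hI) (pseudoscalar_commute hodd) (pseudoscalar_mem_evenOdd_one hodd)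
  obtain ⟨g⟩ := nonempty_even_complexification_equiv_QC_pred hodd.pos.ne'
    (w := fun i : Fin (s + t) => if (i : ℕ) < s then (1 : ℝ) else -1)
    fun i => by split_ifs <;> simp
  exact ⟨⟨f.symm⟩, ⟨f.symm.trans g⟩⟩
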